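/- Let Z be a polygonal curve in ℝ^d with vertices z_0, …, z_n, let 1 ≤ i < j ≤ n, let p be a point on the edge z_{i−1}z_i and q a point on the edge z_{j−1}z_j, and let u, v ∈ ℝ^d. Let Ẑ denote the subcurve of Z from the vertex z_i to the vertex z_{j−1}, and define α = inf over 0 ≤ s ≤ t ≤ 1 of d_F(Ẑ, segment from u + s(v−u) to u + t(v−u)). Then the Fréchet distance between the subcurve of Z from p to q and the segment uv equals max(‖p − u‖, α, ‖q − v‖). -/

import Mathlib

open Set

noncomputable section

namespace Jaywalk

variable {d : ℕ}

/-- An orientation-preserving reparameterization of `[0,1]`: a continuous, strictly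
increasing bijection of `[0,1]` onto itself with `f 0 = 0` and `f 1 = 1`. -/
structure IsReparam (f : ℝ → ℝ) : Prop where
  contOn : ContinuousOn f (Icc 0 1)
  strictMonoOn : StrictMonoOn f (Icc 0 1)
  mapsTo : MapsTo f (Icc 0 1) (Icc 0 1)
  surjOn : SurjOn f (Icc 0 1) (Icc 0 1)
  map_zero : f 0 = 0
  map_one : f 1 = 1

/-- The width of a reparameterization `f` with respect to curves `X Y : [0,1] → ℝ^d`. -/
def frechetWidth (X Y : ℝ → EuclideanSpace ℝ (Fin d)) (f : ℝ → ℝ) : ℝ :=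
  ⨆ t : Icc (0:ℝ) 1, ‖X (f ↑t) - Y ↑t‖

/-- The Fréchet distance between two curves `X Y : [0,1] → ℝ^d`. -/
def frechetDist (X Y : ℝ → EuclideanSpace ℝ (Fin d)) : ℝ :=
  sInf {w | ∃ f, IsReparam f ∧ w = frechetWidth X Y f}

/-- The segment from `p` to `q`, as a curve `t ↦ (1-t)·p + t·q`. -/
def seg (p q : EuclideanSpace ℝ (Fin d)) : ℝ → EuclideanSpace ℝ (Fin d) :=
  fun t => (1 - t) • p + t • q

/-- The subcurve `Z[s,t]`, affinely reparameterized over `[0,1]`. -/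
def subcurve (Z : ℝ → EuclideanSpace ℝ (Fin d)) (s t : ℝ) : ℝ → EuclideanSpace ℝ (Fin d) :=
  fun τ => Z (s + τ * (t - s))

/-- Vertices extended to all of `ℕ` (clamped at `n`). -/
def vtx {n : ℕ} (v : Fin (n+1) → EuclideanSpace ℝ (Fin d)) (i : ℕ) :
    EuclideanSpace ℝ (Fin d) :=
  v ⟨min i n, Nat.lt_succ_of_le (min_le_right i n)⟩

/-- The uniformly parameterized polygonal curve through the vertices `v 0, …, v n`. -/
def polyCurve {n : ℕ} (v : Fin (n+1) → EuclideanSpace ℝ (Fin d)) :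
    ℝ → EuclideanSpace ℝ (Fin d) :=
  fun t =>
    (1 - (t * n - ⌊t * n⌋₊)) • vtx v ⌊t * n⌋₊ + (t * n - ⌊t * n⌋₊) • vtx v (⌊t * n⌋₊ + 1)

/-- Concatenation of two curves (sharing an endpoint). -/
def concat (A B : ℝ → EuclideanSpace ℝ (Fin d)) : ℝ → EuclideanSpace ℝ (Fin d) :=
  fun t => if t ≤ 1/2 then A (2 * t) else B (2 * t - 1)

/-- Concatenation of a finite list of curves. -/
def concatList : List (ℝ → EuclideanSpace ℝ (Fin d)) → ℝ → EuclideanSpace ℝ (Fin d)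
  | [] => fun _ => 0
  | [A] => A
  | A :: B :: rest => concat A (concatList (B :: rest))

/-- Given curves `X Y`, the price of the tunnel from `a` to `b` (points of `[0,1]²`):
the Fréchet distance between the subcurve `X[a.1, b.1]` and the segment from
`Y a.2` to `Y b.2`. -/
def tunnelPrice (X Y : ℝ → EuclideanSpace ℝ (Fin d)) (a b : ℝ × ℝ) : ℝ :=
  frechetDist (subcurve X a.1 b.1) (seg (Y a.2) (Y b.2))

open Classical in
/-- Indices of marked vertices in the greedy `μ`-simplification of the polygonal curve with
vertices `v 0, …, v n`:  start at vertex `0`; repeatedly jump to the first later vertex at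
distance at least `μ` from the current one; finally also mark the last vertex `n`
(the sequence stabilizes at `n`). -/
def simplIdx (v : ℕ → EuclideanSpace ℝ (Fin d)) (μ : ℝ) (n : ℕ) : ℕ → ℕ
  | 0 => 0
  | k+1 =>
    if h : ∃ j, simplIdx v μ n k < j ∧ j ≤ n ∧ μ ≤ ‖v j - v (simplIdx v μ n k)‖
    then Nat.find h
    else n

/-- The vertices of the `μ`-simplification (with the final vertex repeated). -/
def simplVerts {n : ℕ} (v : Fin (n+1) → EuclideanSpace ℝ (Fin d)) (μ : ℝ) :
    Fin (n+1) → EuclideanSpace ℝ (Fin d) :=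
  fun k => vtx v (simplIdx (vtx v) μ n k.val)

/-- The `μ`-simplification `simpl(X, μ)` of the polygonal curve with vertices
`v 0, …, v n`: the polygonal curve through the marked vertices, in order. -/
def simpl {n : ℕ} (v : Fin (n+1) → EuclideanSpace ℝ (Fin d)) (μ : ℝ) :
    ℝ → EuclideanSpace ℝ (Fin d) :=
  polyCurve (simplVerts v μ)

/-- `y` is the parameter of a vertex of a (uniformly parameterized) polygonal curve
with `n` edges. -/
def vertexParam (n : ℕ) (y : ℝ) : Prop := ∃ i : Fin (n+1), y = ((i : ℕ) : ℝ) / n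

/-- The shortcut curve of `Y` determined by the list of shortcut parameter pairs,
starting from parameter `a`. -/
def shortcutFrom (Y : ℝ → EuclideanSpace ℝ (Fin d)) :
    List (ℝ × ℝ) → ℝ → ℝ → EuclideanSpace ℝ (Fin d)
  | [], a => subcurve Y a 1
  | (y₁, y₂) :: rest, a =>
      concat (subcurve Y a y₁) (concat (seg (Y y₁) (Y y₂)) (shortcutFrom Y rest y₂))

/-- The shortcut parameter pairs form a nondecreasing sequence inside `[0,1]` and all
parameters are vertices of the polygonal curve with `n` edges. -/
def ValidShortcuts (n : ℕ) (L : List (ℝ × ℝ)) : Prop :=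
  List.Chain' (· ≤ ·) ((0:ℝ) :: (L.flatMap fun p => [p.1, p.2]) ++ [1]) ∧
  ∀ p ∈ L, vertexParam n p.1 ∧ vertexParam n p.2

/-- The directed vertex-restricted `k`-shortcut Fréchet distance between a curve `X` and the
polygonal curve with vertices `w 0, …, w n`: the infimum of the Fréchet distance between `X`
and any vertex-restricted shortcut curve of `polyCurve w` with at most `k` shortcuts. -/
def shortcutFrechetDist {n : ℕ} (X : ℝ → EuclideanSpace ℝ (Fin d))
    (w : Fin (n+1) → EuclideanSpace ℝ (Fin d)) (k : ℕ) : ℝ :=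
  sInf {r | ∃ L : List (ℝ × ℝ), L.length ≤ k ∧ ValidShortcuts n L ∧
    r = frechetDist X (shortcutFrom (polyCurve w) L 0)}

/-- The directed vertex-restricted shortcut Fréchet distance (unbounded number of
shortcuts). -/
def shortcutFrechetDistUnbounded {n : ℕ} (X : ℝ → EuclideanSpace ℝ (Fin d))
    (w : Fin (n+1) → EuclideanSpace ℝ (Fin d)) : ℝ :=
  sInf {r | ∃ L : List (ℝ × ℝ), ValidShortcuts n L ∧
    r = frechetDist X (shortcutFrom (polyCurve w) L 0)}

lemma isReparam_of_strictMono {f : ℝ → ℝ} (hf : Continuous f) (hm : StrictMono f)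
    (h0 : f 0 = 0) (h1 : f 1 = 1) : IsReparam f where
  contOn := hf.continuousOn
  strictMonoOn := hm.strictMonoOn _
  mapsTo t ht := ⟨h0 ▸ hm.monotone ht.1, h1 ▸ hm.monotone ht.2⟩
  surjOn := by
    have h := intermediate_value_Icc zero_le_one hf.continuousOn
    rwa [h0, h1] at h
  map_zero := h0
  map_one := h1

lemma frechetWidth_nonneg (X Y : ℝ → EuclideanSpace ℝ (Fin d)) (f : ℝ → ℝ) :
    0 ≤ frechetWidth X Y f :=
  Real.iSup_nonneg fun _ => norm_nonneg _

lemma bddBelow_frechetWidths (X Y : ℝ → EuclideanSpace ℝ (Fin d)) :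
    BddBelow {w | ∃ f, IsReparam f ∧ w = frechetWidth X Y f} :=
  ⟨0, by rintro _ ⟨f, -, rfl⟩; exact frechetWidth_nonneg X Y f⟩

lemma frechetDist_nonneg (X Y : ℝ → EuclideanSpace ℝ (Fin d)) : 0 ≤ frechetDist X Y :=
  Real.sInf_nonneg (by rintro _ ⟨f, -, rfl⟩; exact frechetWidth_nonneg X Y f)

lemma norm_sub_le_frechetWidth {X Y : ℝ → EuclideanSpace ℝ (Fin d)} (hX : Continuous X)
    (hY : Continuous Y) {f : ℝ → ℝ} (hf : IsReparam f) {t : ℝ} (ht : t ∈ Icc (0 : ℝ) 1) :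
    ‖X (f t) - Y t‖ ≤ frechetWidth X Y f := by
  have hc : Continuous fun t : Icc (0 : ℝ) 1 => ‖X (f t) - Y t‖ :=
    ((hX.comp (continuousOn_iff_continuous_domRestrict.1 hf.contOn)).sub
      (hY.comp continuous_subtype_val)).norm
  exact le_ciSup (isCompact_range hc).bddAbove (⟨t, ht⟩ : Icc (0 : ℝ) 1)

/-- A strictly increasing perturbation of a monotone map of `[0,1]`. -/
lemma strictMono_perturb {φ : ℝ → ℝ} (hm : Monotone φ) {η : ℝ} (h0 : 0 < η) (h1 : η < 1) :
    StrictMono fun t => (1 - η) * φ t + η * t := fun _ _ hxy =>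
  add_lt_add_of_le_of_lt (mul_le_mul_of_nonneg_left (hm hxy.le) (by linarith))
    (mul_lt_mul_of_pos_left hxy h0)

lemma surjective_perturb {φ : ℝ → ℝ} (hc : Continuous φ) (hm : Monotone φ) {η : ℝ}
    (h0 : 0 < η) (h1 : η < 1) :
    Function.Surjective fun t => (1 - η) * φ t + η * t := by
  refine Continuous.surjective (by fun_prop) ?_ ?_
  · refine Filter.tendsto_atTop_add_left_of_le' _ ((1 - η) * φ 0) ?_
      (Filter.tendsto_id.const_mul_atTop h0)
    filter_upwards [Filter.eventually_ge_atTop 0] with t ht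
    exact mul_le_mul_of_nonneg_left (hm ht) (by linarith)
  · refine Filter.tendsto_atBot_add_left_of_ge' _ ((1 - η) * φ 0) ?_
      (Filter.tendsto_id.const_mul_atBot h0)
    filter_upwards [Filter.eventually_le_atBot 0] with t ht
    exact mul_le_mul_of_nonneg_left (hm ht) (by linarith)

lemma perturb_mem_and_dist_lt {φ : ℝ → ℝ} (hm : Monotone φ) (hφ0 : φ 0 = 0) (hφ1 : φ 1 = 1)
    {η δ : ℝ} (h0 : 0 < η) (h1 : η < 1) (hδ : η < δ) {t : ℝ} (ht : t ∈ Icc (0 : ℝ) 1) :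
    φ t ∈ Icc (0 : ℝ) 1 ∧ (1 - η) * φ t + η * t ∈ Icc (0 : ℝ) 1 ∧
      dist ((1 - η) * φ t + η * t) (φ t) < δ := by
  have a0 : 0 ≤ φ t := hφ0 ▸ hm ht.1
  have a1 : φ t ≤ 1 := hφ1 ▸ hm ht.2
  obtain ⟨t0, t1⟩ := ht
  refine ⟨⟨a0, a1⟩, ⟨by nlinarith, by nlinarith⟩, ?_⟩
  rw [Real.dist_eq, abs_lt]
  constructor <;> nlinarith

/-- Weakly monotone simultaneous traversals bound the Fréchet distance. -/
lemma frechetDist_le_of_monotone {X Y : ℝ → EuclideanSpace ℝ (Fin d)} (hX : Continuous X)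
    (hY : Continuous Y) {φ ψ : ℝ → ℝ} (hφ : Continuous φ) (hφm : Monotone φ)
    (hφ0 : φ 0 = 0) (hφ1 : φ 1 = 1) (hψ : Continuous ψ) (hψm : Monotone ψ)
    (hψ0 : ψ 0 = 0) (hψ1 : ψ 1 = 1) {w : ℝ}
    (h : ∀ t ∈ Icc (0 : ℝ) 1, ‖X (φ t) - Y (ψ t)‖ ≤ w) : frechetDist X Y ≤ w := by
  refine le_of_forall_pos_le_add fun ε hε => ?_
  have uX := isCompact_Icc.uniformContinuousOn_of_continuous
    (hX.continuousOn (s := Icc (0 : ℝ) 1))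
  have uY := isCompact_Icc.uniformContinuousOn_of_continuous
    (hY.continuousOn (s := Icc (0 : ℝ) 1))
  rw [Metric.uniformContinuousOn_iff] at uX uY
  obtain ⟨δ₁, hδ₁, uX⟩ := uX (ε / 2) (by linarith)
  obtain ⟨δ₂, hδ₂, uY⟩ := uY (ε / 2) (by linarith)
  obtain ⟨η, hη, hη'⟩ := exists_between (lt_min (lt_min hδ₁ hδ₂) (zero_lt_one (α := ℝ)))
  obtain ⟨hη'', hη1⟩ := lt_min_iff.1 hη'
  obtain ⟨hη2, hη3⟩ := lt_min_iff.1 hη''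
  let e : ℝ ≃o ℝ := (strictMono_perturb hψm hη hη1).orderIsoOfSurjective _
    (surjective_perturb hψ hψm hη hη1)
  have he : ∀ t, e t = (1 - η) * ψ t + η * t := fun t => rfl
  have e0 : e.symm 0 = 0 := by rw [OrderIso.symm_apply_eq, he, hψ0]; ring
  have e1 : e.symm 1 = 1 := by rw [OrderIso.symm_apply_eq, he, hψ1]; ring
  let f : ℝ → ℝ := fun t => (1 - η) * φ (e.symm t) + η * e.symm t
  have hf : IsReparam f := by
    have hec := e.symm.continuous
    refine isReparam_of_strictMono (by fun_prop)
      ((strictMono_perturb hφm hη hη1).comp e.symm.strictMono) ?_ ?_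
    · simp [f, e0, hφ0]
    · simp [f, e1, hφ1]
  refine (csInf_le (bddBelow_frechetWidths X Y) ⟨f, hf, rfl⟩).trans ?_
  refine ciSup_le fun ⟨t, ht⟩ => ?_
  have hs : e.symm t ∈ Icc (0 : ℝ) 1 :=
    ⟨e0 ▸ e.symm.monotone ht.1, e1 ▸ e.symm.monotone ht.2⟩
  obtain ⟨x1, x2, x3⟩ := perturb_mem_and_dist_lt hφm hφ0 hφ1 hη hη1 hη2 hs
  obtain ⟨y1, y2, y3⟩ := perturb_mem_and_dist_lt hψm hψ0 hψ1 hη hη1 hη3 hs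
  have bX := uX _ x2 _ x1 x3
  have bY := uY _ y2 _ y1 y3
  rw [← he, OrderIso.apply_symm_apply] at bY
  have b := h _ hs
  rw [← dist_eq_norm] at b ⊢
  rw [dist_comm] at bY
  have := dist_triangle4 (X (f t)) (X (φ (e.symm t))) (Y (ψ (e.symm t))) (Y t)
  change dist (X (f t)) (X (φ (e.symm t))) < _ at bX
  change dist (X (f t)) (Y t) ≤ _
  linarith

/-- The parts `Z[a,b]` and `Y[c,e]` can be traversed simultaneously, without going backwards,
at distance at most `w` from each other. -/
def Matchable (Z Y : ℝ → EuclideanSpace ℝ (Fin d)) (a b c e w : ℝ) : Prop :=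
  ∃ φ ψ : ℝ → ℝ, Continuous φ ∧ Monotone φ ∧ φ 0 = a ∧ φ 1 = b ∧
    Continuous ψ ∧ Monotone ψ ∧ ψ 0 = c ∧ ψ 1 = e ∧
    ∀ t ∈ Icc (0 : ℝ) 1, ‖Z (φ t) - Y (ψ t)‖ ≤ w

lemma exists_normalized {φ : ℝ → ℝ} (hc : Continuous φ) (hm : Monotone φ) :
    ∃ ρ : ℝ → ℝ, Continuous ρ ∧ Monotone ρ ∧ ρ 0 = 0 ∧ ρ 1 = 1 ∧
      ∀ t ∈ Icc (0 : ℝ) 1, φ 0 + ρ t * (φ 1 - φ 0) = φ t := by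
  rcases (hm zero_le_one).eq_or_lt with h | h
  · refine ⟨id, continuous_id, monotone_id, rfl, rfl, fun t ht => ?_⟩
    rw [← h, sub_self, mul_zero, add_zero]
    exact le_antisymm (hm ht.1) (h ▸ hm ht.2)
  · have h' : 0 < φ 1 - φ 0 := sub_pos.2 h
    refine ⟨fun t => (φ t - φ 0) / (φ 1 - φ 0), by fun_prop, fun x y hxy => ?_, by simp,
      div_self h'.ne', fun t _ => by field_simp; ring⟩
    have := hm hxy
    dsimp only
    gcongr

lemma continuous_subcurve {Z : ℝ → EuclideanSpace ℝ (Fin d)} (hZ : Continuous Z) (a b : ℝ) :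
    Continuous (subcurve Z a b) := by
  unfold subcurve; fun_prop

lemma Matchable.frechetDist_le {Z Y : ℝ → EuclideanSpace ℝ (Fin d)} (hZ : Continuous Z)
    (hY : Continuous Y) {a b c e w : ℝ} (h : Matchable Z Y a b c e w) :
    frechetDist (subcurve Z a b) (subcurve Y c e) ≤ w := by
  obtain ⟨φ, ψ, hφ, hφm, rfl, rfl, hψ, hψm, rfl, rfl, h⟩ := h
  obtain ⟨ρ, hρ, hρm, hρ0, hρ1, eρ⟩ := exists_normalized hφ hφm
  obtain ⟨σ, hσ, hσm, hσ0, hσ1, eσ⟩ := exists_normalized hψ hψm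
  refine frechetDist_le_of_monotone (continuous_subcurve hZ _ _) (continuous_subcurve hY _ _)
    hρ hρm hρ0 hρ1 hσ hσm hσ0 hσ1 fun t ht => ?_
  simpa only [subcurve, eρ t ht, eσ t ht] using h t ht

lemma matchable_of_frechetDist_lt {Z Y : ℝ → EuclideanSpace ℝ (Fin d)} (hZ : Continuous Z)
    (hY : Continuous Y) {a b c e w : ℝ} (hab : a ≤ b) (hce : c ≤ e)
    (h : frechetDist (subcurve Z a b) (subcurve Y c e) < w) : Matchable Z Y a b c e w := by
  obtain ⟨_, ⟨f, hf, rfl⟩, hw⟩ := exists_lt_of_csInf_lt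
    (⟨_, id, isReparam_of_strictMono continuous_id strictMono_id rfl rfl, rfl⟩ :
      {w | ∃ f, IsReparam f ∧
        w = frechetWidth (subcurve Z a b) (subcurve Y c e) f}.Nonempty) h
  let g : ℝ → ℝ := IccExtend zero_le_one (domRestrict (Icc (0 : ℝ) 1) f)
  have hg : ∀ t ∈ Icc (0 : ℝ) 1, g t = f t := fun t ht => IccExtend_of_mem _ _ ht
  have hgc : Continuous g := (continuousOn_iff_continuous_domRestrict.1 hf.contOn).Icc_extend'
  have hgm : Monotone g :=
    Monotone.IccExtend _ fun x y hxy => hf.strictMonoOn.monotoneOn x.2 y.2 hxy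
  have g0 : g 0 = 0 := (hg 0 (by simp)).trans hf.map_zero
  have g1 : g 1 = 1 := (hg 1 (by simp)).trans hf.map_one
  refine ⟨fun t => a + g t * (b - a), fun t => c + t * (e - c), by fun_prop,
    fun x y hxy => ?_, by simp [g0], by simp [g1], by fun_prop, fun x y hxy => ?_, by simp,
    by simp, fun t ht => ?_⟩
  · have := mul_le_mul_of_nonneg_right (hgm hxy) (sub_nonneg.2 hab)
    dsimp only; linarith
  · have := mul_le_mul_of_nonneg_right hxy (sub_nonneg.2 hce)
    dsimp only; linarith
  · dsimp only
    rw [hg t ht]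
    exact (norm_sub_le_frechetWidth (continuous_subcurve hZ a b) (continuous_subcurve hY c e)
      hf ht).trans hw.le

lemma Matchable.trans {Z Y : ℝ → EuclideanSpace ℝ (Fin d)} {a b b' c e e' w : ℝ}
    (h₁ : Matchable Z Y a b c e w) (h₂ : Matchable Z Y b b' e e' w) :
    Matchable Z Y a b' c e' w := by
  obtain ⟨φ₁, ψ₁, hφ₁, mφ₁, rfl, rfl, hψ₁, mψ₁, rfl, rfl, h₁⟩ := h₁
  obtain ⟨φ₂, ψ₂, hφ₂, mφ₂, eφ, rfl, hψ₂, mψ₂, eψ, rfl, h₂⟩ := h₂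
  have glueMono : ∀ {α β : ℝ → ℝ}, Monotone α → Monotone β →
      Monotone fun t => α (min (2 * t) 1) + β (max (2 * t - 1) 0) - α 1 := by
    intro α β hα hβ x y hxy
    have h1 := hα (min_le_min_right 1 (mul_le_mul_of_nonneg_left hxy zero_le_two))
    have h2 := hβ (max_le_max_right 0 (sub_le_sub_right
      (mul_le_mul_of_nonneg_left hxy (zero_le_two (α := ℝ))) 1))
    dsimp only; linarith
  refine ⟨_, _, ?_, glueMono mφ₁ mφ₂, ?_, ?_, ?_, glueMono mψ₁ mψ₂, ?_, ?_, ?_⟩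
  · fun_prop
  · norm_num [eφ]
  · norm_num
  · fun_prop
  · norm_num [eψ]
  · norm_num
  · rintro t ⟨t0, t1⟩
    rcases le_total (2 * t) 1 with h | h
    · simpa [min_eq_left h, max_eq_right (sub_nonpos.2 h), eφ, eψ] using
        h₁ (2 * t) ⟨by linarith, h⟩
    · simpa [min_eq_right h, max_eq_left (sub_nonneg.2 h)] using
        h₂ (2 * t - 1) ⟨by linarith, by linarith⟩

lemma Matchable.norm_left_le {Z Y : ℝ → EuclideanSpace ℝ (Fin d)} {a b c e w : ℝ}
    (h : Matchable Z Y a b c e w) : ‖Z a - Y c‖ ≤ w := by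
  obtain ⟨φ, ψ, -, -, rfl, -, -, -, rfl, -, h⟩ := h
  exact h 0 (by simp)

lemma Matchable.norm_right_le {Z Y : ℝ → EuclideanSpace ℝ (Fin d)} {a b c e w : ℝ}
    (h : Matchable Z Y a b c e w) : ‖Z b - Y e‖ ≤ w := by
  obtain ⟨φ, ψ, -, -, -, rfl, -, -, -, rfl, h⟩ := h
  exact h 1 (by simp)

lemma Matchable.exists_restrict {Z Y : ℝ → EuclideanSpace ℝ (Fin d)} {a b c e w a' b' : ℝ}
    (h : Matchable Z Y a b c e w) (ha : a ≤ a') (hab : a' ≤ b') (hb : b' ≤ b) :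
    ∃ s t, c ≤ s ∧ s ≤ t ∧ t ≤ e ∧ Matchable Z Y a' b' s t w := by
  obtain ⟨φ, ψ, hφ, mφ, rfl, rfl, hψ, mψ, rfl, rfl, h⟩ := h
  obtain ⟨t₁, ht₁, rfl⟩ := intermediate_value_Icc zero_le_one hφ.continuousOn
    ⟨ha, hab.trans hb⟩
  obtain ⟨t₂, ht₂, rfl⟩ := intermediate_value_Icc ht₁.2 hφ.continuousOn ⟨hab, hb⟩
  have hl : Monotone fun x : ℝ => t₁ + x * (t₂ - t₁) := fun x y hxy => by
    have := mul_le_mul_of_nonneg_right hxy (sub_nonneg.2 ht₂.1)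
    dsimp only; linarith
  refine ⟨ψ t₁, ψ t₂, mψ ht₁.1, mψ ht₂.1, mψ ht₂.2, _, _, hφ.comp (by fun_prop), mφ.comp hl,
    by simp, by simp, hψ.comp (by fun_prop), mψ.comp hl, by simp, by simp, fun x hx => ?_⟩
  refine h _ ⟨?_, ?_⟩
  · have := hl hx.1
    simp only [zero_mul, add_zero] at this
    exact ht₁.1.trans this
  · have := hl hx.2
    simp only [one_mul, add_sub_cancel] at this
    exact this.trans ht₂.2

/-- Two affine pieces can be matched at the larger of the distances of their endpoints. -/
lemma matchable_of_affine {Z Y : ℝ → EuclideanSpace ℝ (Fin d)} {a b c e w : ℝ}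
    (hab : a ≤ b) (hce : c ≤ e)
    (hZ : ∀ x ∈ Icc (0 : ℝ) 1, subcurve Z a b x = seg (Z a) (Z b) x)
    (hY : ∀ x ∈ Icc (0 : ℝ) 1, subcurve Y c e x = seg (Y c) (Y e) x)
    (h₁ : ‖Z a - Y c‖ ≤ w) (h₂ : ‖Z b - Y e‖ ≤ w) : Matchable Z Y a b c e w := by
  have hl : ∀ {a b : ℝ}, a ≤ b → Monotone fun x : ℝ => a + x * (b - a) :=
    fun hab x y hxy => by
      have := mul_le_mul_of_nonneg_right hxy (sub_nonneg.2 hab)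
      dsimp only; linarith
  refine ⟨_, _, by fun_prop, hl hab, by simp, by simp, by fun_prop, hl hce, by simp, by simp,
    fun x hx => ?_⟩
  have h := congrArg₂ (· - ·) (hZ x hx) (hY x hx)
  simp only [subcurve, seg] at h
  rw [h]
  have hsum : (1 - x) • Z a + x • Z b - ((1 - x) • Y c + x • Y e) =
      (1 - x) • (Z a - Y c) + x • (Z b - Y e) := by module
  rw [hsum]
  have h0 := hx.1
  have h1 : 0 ≤ 1 - x := sub_nonneg.2 hx.2
  calc _ ≤ ‖(1 - x) • (Z a - Y c)‖ + ‖x • (Z b - Y e)‖ := norm_add_le _ _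
    _ = (1 - x) * ‖Z a - Y c‖ + x * ‖Z b - Y e‖ := by
      rw [norm_smul, norm_smul, Real.norm_of_nonneg h0, Real.norm_of_nonneg h1]
    _ ≤ (1 - x) * w + x * w := by gcongr
    _ = w := by ring

lemma interpolate_eq (w : ℕ → EuclideanSpace ℝ (Fin d)) (k : ℕ) {x : ℝ}
    (hx : x ∈ Icc (k : ℝ) (k + 1)) :
    (1 - (x - ⌊x⌋₊)) • w ⌊x⌋₊ + (x - ⌊x⌋₊) • w (⌊x⌋₊ + 1) =
      (1 - (x - k)) • w k + (x - k) • w (k + 1) := by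
  rcases hx.2.eq_or_lt with rfl | h
  · have : ⌊(k : ℝ) + 1⌋₊ = k + 1 := by exact_mod_cast Nat.floor_natCast (R := ℝ) (k + 1)
    simp [this]
  · have : ⌊x⌋₊ = k := (Nat.floor_eq_iff (k.cast_nonneg.trans hx.1)).2 ⟨hx.1, h⟩
    rw [this]

lemma continuous_interpolate (w : ℕ → EuclideanSpace ℝ (Fin d)) :
    Continuous fun x : ℝ => (1 - (x - ⌊x⌋₊)) • w ⌊x⌋₊ + (x - ⌊x⌋₊) • w (⌊x⌋₊ + 1) := by
  have key : ∀ k : ℕ, ContinuousOn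
      (fun x : ℝ => (1 - (x - ⌊x⌋₊)) • w ⌊x⌋₊ + (x - ⌊x⌋₊) • w (⌊x⌋₊ + 1)) (Iic (k : ℝ)) := by
    intro k
    induction k with
    | zero =>
      have hc : Continuous fun x : ℝ => (1 - x) • w 0 + x • w 1 := by fun_prop
      refine hc.continuousOn.congr fun x hx => ?_
      have : ⌊x⌋₊ = 0 := Nat.floor_of_nonpos (by simpa using hx)
      simp [this]
    | succ k ih =>
      have hc : Continuous fun x : ℝ => (1 - (x - k)) • w k + (x - k) • w (k + 1) := by fun_prop
      have hu : Iic ((k + 1 : ℕ) : ℝ) = Iic (k : ℝ) ∪ Icc (k : ℝ) (k + 1) := by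
        rw [Iic_union_Icc_eq_Iic (by linarith)]
        push_cast; rfl
      rw [hu]
      exact ih.union_of_isClosed (hc.continuousOn.congr fun x hx => interpolate_eq w k hx)
        isClosed_Iic isClosed_Icc
  refine continuous_iff_continuousAt.2 fun x => ?_
  obtain ⟨k, hk⟩ := exists_nat_gt x
  exact (key k).continuousAt (Iic_mem_nhds hk)

lemma continuous_polyCurve {n : ℕ} (z : Fin (n + 1) → EuclideanSpace ℝ (Fin d)) :
    Continuous (polyCurve z) :=
  (continuous_interpolate (vtx z)).comp (f := fun t : ℝ => t * n) (by fun_prop)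

lemma polyCurve_edge {n : ℕ} (hn : 0 < n) (z : Fin (n + 1) → EuclideanSpace ℝ (Fin d)) (k : ℕ)
    {s : ℝ} (hs : s ∈ Icc (0 : ℝ) 1) :
    polyCurve z ((k + s) / n) = (1 - s) • vtx z k + s • vtx z (k + 1) := by
  have hn' : (n : ℝ) ≠ 0 := by positivity
  have h := interpolate_eq (vtx z) k (x := k + s) ⟨by linarith [hs.1], by linarith [hs.2]⟩
  rw [add_sub_cancel_left (k : ℝ) s] at h
  rw [polyCurve, div_mul_cancel₀ _ hn', h]

/-- A subcurve of a polygonal curve inside a single edge is a segment. -/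
lemma subcurve_polyCurve_edge {n : ℕ} (hn : 0 < n) (z : Fin (n + 1) → EuclideanSpace ℝ (Fin d))
    (k : ℕ) {s t : ℝ} (hs : s ∈ Icc (0 : ℝ) 1) (ht : t ∈ Icc (0 : ℝ) 1) {x : ℝ}
    (hx : x ∈ Icc (0 : ℝ) 1) :
    subcurve (polyCurve z) ((k + s) / n) ((k + t) / n) x =
      seg (polyCurve z ((k + s) / n)) (polyCurve z ((k + t) / n)) x := by
  have hm : (1 - x) * s + x * t ∈ Icc (0 : ℝ) 1 :=
    convex_Icc (0 : ℝ) 1 hs ht (sub_nonneg.2 hx.2) hx.1 (by ring)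
  have e : ((k : ℝ) + s) / n + x * ((k + t) / n - (k + s) / n) =
      (k + ((1 - x) * s + x * t)) / n := by ring
  rw [subcurve, e, polyCurve_edge hn z k hm, seg, polyCurve_edge hn z k hs,
    polyCurve_edge hn z k ht]
  module

lemma continuous_seg (u v : EuclideanSpace ℝ (Fin d)) : Continuous (seg u v) := by
  unfold seg; fun_prop

lemma seg_eq_subcurve (u v : EuclideanSpace ℝ (Fin d)) (s t : ℝ) :
    seg (u + s • (v - u)) (u + t • (v - u)) = subcurve (seg u v) s t := by
  ext1 x
  simp only [seg, subcurve]
  module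

lemma subcurve_zero_one (Y : ℝ → EuclideanSpace ℝ (Fin d)) : subcurve Y 0 1 = Y := by
  ext1 x
  simp [subcurve]

lemma subcurve_seg (u v : EuclideanSpace ℝ (Fin d)) (s t x : ℝ) :
    subcurve (seg u v) s t x = seg (seg u v s) (seg u v t) x := by
  simp only [seg, subcurve]
  module

/-- Let `Z` be a polygonal curve with vertices `z 0, …, z n`, let
`1 ≤ i < j ≤ n`, let `p = Z(((i-1)+sp)/n)` be a point on the edge `z (i-1) z i` and
`q = Z(((j-1)+sq)/n)` a point on the edge `z (j-1) z j`.  With `Ẑ` the subcurve of `Z`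
from vertex `z i` to vertex `z (j-1)` and
`α = inf_{0 ≤ s ≤ t ≤ 1} d_F(Ẑ, seg (u + s(v-u)) (u + t(v-u)))`, the Fréchet distance
between the subcurve of `Z` from `p` to `q` and the segment `uv` equals
`max(‖p − u‖, α, ‖q − v‖)`. -/
theorem frechetDist_tunnel_eq {d n : ℕ} (z : Fin (n+1) → EuclideanSpace ℝ (Fin d))
    (i j : ℕ) (hi : 1 ≤ i) (hij : i < j) (hj : j ≤ n)
    (sp sq : ℝ) (hsp : sp ∈ Icc (0:ℝ) 1) (hsq : sq ∈ Icc (0:ℝ) 1)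
    (u v : EuclideanSpace ℝ (Fin d)) :
    frechetDist
        (subcurve (polyCurve z) (((i:ℝ) - 1 + sp) / n) (((j:ℝ) - 1 + sq) / n))
        (seg u v) =
      max ‖polyCurve z (((i:ℝ) - 1 + sp) / n) - u‖
        (max
          (sInf {w | ∃ s t : ℝ, 0 ≤ s ∧ s ≤ t ∧ t ≤ 1 ∧
            w = frechetDist (subcurve (polyCurve z) ((i:ℝ) / n) (((j:ℝ) - 1) / n))
                  (seg (u + s • (v - u)) (u + t • (v - u)))})
          ‖polyCurve z (((j:ℝ) - 1 + sq) / n) - v‖) := by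
  have hn : 0 < n := by omega
  obtain ⟨k, rfl⟩ : ∃ k, i = k + 1 := ⟨i - 1, by omega⟩
  obtain ⟨l, rfl⟩ : ∃ l, j = l + 1 := ⟨j - 1, by omega⟩
  have hkl : (k : ℝ) + 1 ≤ l := by exact_mod_cast Nat.lt_succ_iff.1 hij
  push_cast
  simp only [add_sub_cancel_right, seg_eq_subcurve]
  have hZ := continuous_polyCurve z
  have hY := continuous_seg u v
  have hap : ((k : ℝ) + sp) / n ≤ (k + 1) / n := by gcongr; exact hsp.2
  have hpq : ((k : ℝ) + 1) / n ≤ l / n := by gcongr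
  have hqb : (l : ℝ) / n ≤ (l + sq) / n := by gcongr; linarith [hsq.1]
  have y0 : seg u v 0 = u := by simp [seg]
  have y1 : seg u v 1 = v := by simp [seg]
  have hbdd : BddBelow {w | ∃ s t : ℝ, 0 ≤ s ∧ s ≤ t ∧ t ≤ 1 ∧
      w = frechetDist (subcurve (polyCurve z) (((k : ℝ) + 1) / n) ((l : ℝ) / n))
        (subcurve (seg u v) s t)} :=
    ⟨0, by rintro _ ⟨s, t, -, -, -, rfl⟩; exact frechetDist_nonneg _ _⟩
  have hp : ∀ x ∈ Icc (0 : ℝ) 1, subcurve (polyCurve z) ((k + sp) / n) ((k + 1) / n) x =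
      seg (polyCurve z ((k + sp) / n)) (polyCurve z ((k + 1) / n)) x :=
    fun x hx => subcurve_polyCurve_edge hn z k hsp (by simp) hx
  have hq : ∀ x ∈ Icc (0 : ℝ) 1, subcurve (polyCurve z) (l / n) ((l + sq) / n) x =
      seg (polyCurve z (l / n)) (polyCurve z ((l + sq) / n)) x := fun x hx => by
    simpa using subcurve_polyCurve_edge hn z l (s := 0) (by simp) hsq hx
  apply le_antisymm
  · refine le_of_forall_gt_imp_ge_of_dense fun w hw => ?_
    obtain ⟨hpw, hw⟩ := max_lt_iff.1 hw
    obtain ⟨hα, hqw⟩ := max_lt_iff.1 hw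
    obtain ⟨_, ⟨s, t, hs, hst, ht, rfl⟩, hd⟩ := (csInf_lt_iff hbdd
      ⟨_, 0, 0, le_rfl, le_rfl, zero_le_one, rfl⟩).1 hα
    have hmid := matchable_of_frechetDist_lt hZ hY hpq hst hd
    have hleft := matchable_of_affine hap hs hp (fun x _ => subcurve_seg u v 0 s x)
      (by rw [y0]; exact hpw.le) hmid.norm_left_le
    have hright := matchable_of_affine hqb ht hq (fun x _ => subcurve_seg u v t 1 x)
      hmid.norm_right_le (by rw [y1]; exact hqw.le)
    rw [← subcurve_zero_one (seg u v)]
    exact ((hleft.trans hmid).trans hright).frechetDist_le hZ hY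
  · refine le_of_forall_gt_imp_ge_of_dense fun w hw => ?_
    rw [← subcurve_zero_one (seg u v)] at hw
    have h := matchable_of_frechetDist_lt hZ hY ((hap.trans hpq).trans hqb) zero_le_one hw
    refine max_le (y0 ▸ h.norm_left_le) (max_le ?_ (y1 ▸ h.norm_right_le))
    obtain ⟨s, t, hs, hst, ht, hm⟩ := h.exists_restrict hap hpq hqb
    exact (csInf_le hbdd ⟨s, t, hs, hst, ht, rfl⟩).trans (hm.frechetDist_le hZ hY)

end Jaywalk
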